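/- For all integers k ≥ 2 and d ≥ 2, liminf_{n→∞} E_{k,d}(n)/n ≥ (2/k) · liminf_{n→∞} E_{2,d}(n)/n. (This expresses the inequality γ_{k,d} ≥ (2/k)·γ_{2,d} between the generalized Chvátal–Sankoff constants.) -/

import Mathlib

/-- The length of the longest common subsequence of the `d` strings `X 0, …, X (d-1)`
over the alphabet `Fin k`. -/
noncomputable def lcsLen {k : ℕ} (d : ℕ) (X : Fin d → List (Fin k)) : ℕ :=
  sSup {m : ℕ | ∃ w : List (Fin k), w.length = m ∧ ∀ i : Fin d, w.Sublist (X i)}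

/-- `expLCS k d n` is the expected LCS length of `d` independent uniformly random strings
of length `n` over an alphabet of size `k`. -/
noncomputable def expLCS (k d n : ℕ) : ℝ :=
  (∑ X : Fin d → Fin n → Fin k, (lcsLen d (fun i => List.ofFn (X i)) : ℝ)) /
    (Fintype.card (Fin d → Fin n → Fin k) : ℝ)

open Filter Topology

theorem bddAbove_commonSublist_length {k d : ℕ} (hd : 0 < d) (X : Fin d → List (Fin k)) :
    BddAbove {m : ℕ | ∃ w : List (Fin k), w.length = m ∧ ∀ i : Fin d, w.Sublist (X i)} := by
  refine ⟨(X ⟨0, hd⟩).length, ?_⟩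
  rintro m ⟨w, rfl, hw⟩
  exact (hw _).length_le

theorem exists_commonSublist_length_eq_lcsLen {k d : ℕ} (hd : 0 < d) (X : Fin d → List (Fin k)) :
    ∃ w : List (Fin k), w.length = lcsLen d X ∧ ∀ i : Fin d, w.Sublist (X i) :=
  Nat.sSup_mem (s := {m : ℕ | ∃ w : List (Fin k), w.length = m ∧ ∀ i : Fin d, w.Sublist (X i)})
    ⟨0, [], rfl, fun _ => List.nil_sublist _⟩ (bddAbove_commonSublist_length hd X)

theorem length_le_lcsLen {k d : ℕ} (hd : 0 < d) (X : Fin d → List (Fin k)) (w : List (Fin k))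
    (hw : ∀ i, w.Sublist (X i)) : w.length ≤ lcsLen d X :=
  le_csSup (bddAbove_commonSublist_length hd X) ⟨w, rfl, hw⟩

theorem lcsLen_ofFn_le {k d n : ℕ} (hd : 0 < d) (X : Fin d → Fin n → Fin k) :
    lcsLen d (fun i => List.ofFn (X i)) ≤ n := by
  obtain ⟨w, hw, hs⟩ := exists_commonSublist_length_eq_lcsLen hd (fun i => List.ofFn (X i))
  rw [← hw]
  simpa using (hs ⟨0, hd⟩).length_le

theorem List.ofFn_comp_sublist {α : Type*} {m n : ℕ} (W : Fin n → α) (e : Fin m ↪o Fin n) :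
    (List.ofFn (W ∘ e)).Sublist (List.ofFn W) := by
  rw [List.sublist_iff_exists_fin_orderEmbedding_get_eq]
  refine ⟨((Fin.castOrderIso (by simp)).toOrderEmbedding.trans e).trans
    (Fin.castOrderIso (by simp)).toOrderEmbedding, fun i => ?_⟩
  simp
  rfl

/-- Strings containing relabelled copies of other strings as subsequences have a longer LCS. -/
theorem lcsLen_ofFn_le_of_comp_eq {k l d m n : ℕ} (hd : 0 < d) (f : Fin l → Fin k)
    (Z : Fin d → Fin m → Fin l) (W : Fin d → Fin n → Fin k) (e : Fin d → Fin m ↪o Fin n)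
    (h : ∀ i j, W i (e i j) = f (Z i j)) :
    lcsLen d (fun i => List.ofFn (Z i)) ≤ lcsLen d (fun i => List.ofFn (W i)) := by
  obtain ⟨w, hw, hs⟩ := exists_commonSublist_length_eq_lcsLen hd (fun i => List.ofFn (Z i))
  rw [← hw, ← List.length_map (f := f)]
  refine length_le_lcsLen hd _ _ fun i => ((hs i).map f).trans ?_
  have : List.map f (List.ofFn (Z i)) = List.ofFn (W i ∘ e i) := by
    rw [List.map_ofFn]
    congr 1
    funext j
    exact (h i j).symm
  rw [this]
  exact List.ofFn_comp_sublist _ _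

theorem expLCS_nonneg (k d n : ℕ) : 0 ≤ expLCS k d n := by
  unfold expLCS; positivity

theorem expLCS_le (k d n : ℕ) (hd : 0 < d) : expLCS k d n ≤ n := by
  unfold expLCS
  refine div_le_of_le_mul₀ (by positivity) (by positivity) ?_
  calc _ ≤ ∑ X : Fin d → Fin n → Fin k, (n : ℝ) :=
        Finset.sum_le_sum fun X _ => by exact_mod_cast lcsLen_ofFn_le hd X
    _ = _ := by
        rw [Finset.sum_const, Finset.card_univ, nsmul_eq_mul, mul_comm]

/-- A surjective homomorphism of finite groups pushes the uniform measure to the uniform one. -/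
theorem sum_comp_surjective_addMonoidHom {G H : Type*} [AddCommGroup G] [AddCommGroup H] [Fintype G]
    [Fintype H] (π : G →+ H) (hπ : Function.Surjective π) (F : H → ℝ) :
    (Fintype.card H : ℝ) * ∑ g, F (π g) = Fintype.card G * ∑ h, F h := by
  have key (h : H) : ∑ g, F (π g) = ∑ g, F (π g + h) := by
    obtain ⟨s, rfl⟩ := hπ h
    rw [← Equiv.sum_comp (Equiv.addRight s)]
    simp
  calc (Fintype.card H : ℝ) * ∑ g, F (π g) = ∑ h : H, ∑ g, F (π g) := by simp
    _ = ∑ h : H, ∑ g, F (π g + h) := Finset.sum_congr rfl fun h _ => key h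
    _ = ∑ g, ∑ h : H, F (π g + h) := Finset.sum_comm
    _ = ∑ g : G, ∑ h : H, F h :=
        Finset.sum_congr rfl fun g _ => Equiv.sum_comp (Equiv.addLeft (π g)) F
    _ = _ := by simp

/-- The letter permutation of `Fin k` extending `b ↦ b + y` on `Fin 2`. -/
def binaryShift {k : ℕ} (hk : 2 ≤ k) (y : Fin 2) : Equiv.Perm (Fin k) :=
  if y = 0 then Equiv.refl _ else Equiv.swap (Fin.castLE hk 0) (Fin.castLE hk 1)

theorem binaryShift_castLE {k : ℕ} (hk : 2 ≤ k) (y b : Fin 2) :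
    binaryShift hk y (Fin.castLE hk b) = Fin.castLE hk (b + y) := by
  fin_cases y <;> fin_cases b <;> simp [binaryShift]

/-- The positions of a `k`-ary string that hold one of the first two letters. -/
def binaryPositions {k n : ℕ} (x : Fin n → Fin k) : Finset (Fin n) :=
  Finset.univ.filter fun j => (x j : ℕ) < 2

theorem card_mul_expLCS_two_le {k d n m : ℕ} (hk : 2 ≤ k) (hd : 0 < d) (X : Fin d → Fin n → Fin k)
    (hm : ∀ i, m ≤ (binaryPositions (X i)).card) :
    (Fintype.card (Fin d → Fin n → Fin 2) : ℝ) * expLCS 2 d m ≤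
      ∑ Y : Fin d → Fin n → Fin 2,
        (lcsLen d (fun i => List.ofFn fun j => binaryShift hk (Y i j) (X i j)) : ℝ) := by
  let e (i : Fin d) : Fin m ↪o Fin n := (binaryPositions (X i)).orderEmbOfCardLe (hm i)
  have he (i : Fin d) (j : Fin m) : (X i (e i j) : ℕ) < 2 := by
    have := (binaryPositions (X i)).orderEmbOfCardLe_mem (hm i) j
    exact (Finset.mem_filter.mp this).2
  let V : Fin d → Fin m → Fin 2 := fun i j => ⟨X i (e i j), he i j⟩
  let π : (Fin d → Fin n → Fin 2) →+ (Fin d → Fin m → Fin 2) :=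
    { toFun := fun Y i j => Y i (e i j)
      map_zero' := rfl
      map_add' := fun _ _ => rfl }
  have hπ : Function.Surjective π := by
    intro Z
    refine ⟨fun i => Function.extend (e i) (Z i) 0, ?_⟩
    funext i j
    exact (e i).injective.extend_apply _ _ _
  have hle (Y : Fin d → Fin n → Fin 2) : lcsLen d (fun i => List.ofFn ((V + π Y) i)) ≤
      lcsLen d (fun i => List.ofFn fun j => binaryShift hk (Y i j) (X i j)) := by
    refine lcsLen_ofFn_le_of_comp_eq hd (Fin.castLE hk) _ _ e fun i j => ?_
    exact binaryShift_castLE hk (Y i (e i j)) (V i j)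
  have hsum := sum_comp_surjective_addMonoidHom π hπ
    (fun Z => (lcsLen d (fun i => List.ofFn ((V + Z) i)) : ℝ))
  have hshift : ∑ Z, (lcsLen d (fun i => List.ofFn ((V + Z) i)) : ℝ) =
      ∑ Z : Fin d → Fin m → Fin 2, (lcsLen d (fun i => List.ofFn (Z i)) : ℝ) :=
    Equiv.sum_comp (Equiv.addLeft V)
      (fun Z : Fin d → Fin m → Fin 2 => (lcsLen d (fun i => List.ofFn (Z i)) : ℝ))
  rw [hshift] at hsum
  have hH : (0 : ℝ) < Fintype.card (Fin d → Fin m → Fin 2) := by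
    exact_mod_cast Fintype.card_pos
  calc _ = ∑ Y, (lcsLen d (fun i => List.ofFn ((V + π Y) i)) : ℝ) := by
        unfold expLCS
        rw [mul_div_assoc', ← hsum, mul_div_cancel_left₀ _ hH.ne']
    _ ≤ _ := Finset.sum_le_sum fun Y _ => by exact_mod_cast hle Y

theorem sum_expLCS_two_le {k d n : ℕ} (hk : 2 ≤ k) (hd : 0 < d) (m : (Fin d → Fin n → Fin k) → ℕ)
    (hm : ∀ X i, m X ≤ (binaryPositions (X i)).card) :
    ∑ X, expLCS 2 d (m X) ≤
      ∑ X : Fin d → Fin n → Fin k, (lcsLen d (fun i => List.ofFn (X i)) : ℝ) := by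
  have hG : (0 : ℝ) < Fintype.card (Fin d → Fin n → Fin 2) := by
    exact_mod_cast Fintype.card_pos
  refine le_of_mul_le_mul_left ?_ hG
  calc _ = ∑ X, (Fintype.card (Fin d → Fin n → Fin 2) : ℝ) * expLCS 2 d (m X) :=
        Finset.mul_sum _ _ _
    _ ≤ ∑ X : Fin d → Fin n → Fin k, ∑ Y : Fin d → Fin n → Fin 2,
        (lcsLen d (fun i => List.ofFn fun j => binaryShift hk (Y i j) (X i j)) : ℝ) :=
        Finset.sum_le_sum fun X _ => card_mul_expLCS_two_le hk hd X (hm X)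
    _ = ∑ Y : Fin d → Fin n → Fin 2, ∑ X : Fin d → Fin n → Fin k,
        (lcsLen d (fun i => List.ofFn fun j => binaryShift hk (Y i j) (X i j)) : ℝ) :=
        Finset.sum_comm
    _ = ∑ Y : Fin d → Fin n → Fin 2, ∑ X : Fin d → Fin n → Fin k,
        (lcsLen d (fun i => List.ofFn (X i)) : ℝ) :=
        Finset.sum_congr rfl fun Y _ => Equiv.sum_comp
          (Equiv.piCongrRight fun i => Equiv.piCongrRight fun j => binaryShift hk (Y i j))
          (fun X : Fin d → Fin n → Fin k => (lcsLen d (fun i => List.ofFn (X i)) : ℝ))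
    _ = _ := by simp

/-- The centred indicator of the first two letters. -/
noncomputable def centredBinary {k : ℕ} (x : Fin k) : ℝ := (if (x : ℕ) < 2 then 1 else 0) - 2 / k

theorem sum_centredBinary {k : ℕ} (hk : 2 ≤ k) : ∑ x : Fin k, centredBinary x = 0 := by
  have h0 : (k : ℝ) ≠ 0 := by positivity
  obtain ⟨l, rfl⟩ := Nat.exists_eq_add_of_le hk
  simp only [centredBinary, Finset.sum_sub_distrib]
  rw [Fin.sum_univ_add]
  have h1 : ∀ x : Fin 2, (x : ℕ) < 2 := fun x => x.isLt
  have h2 : ∀ x : Fin l, ¬ 2 + (x : ℕ) < 2 := fun x => by omega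
  simp only [Fin.val_castAdd, Fin.val_natAdd, h1, h2, if_true, if_false, Finset.sum_const,
    Finset.card_univ, Fintype.card_fin, nsmul_eq_mul, mul_zero, add_zero]
  field_simp
  push_cast
  ring

theorem centredBinary_sq_le {k : ℕ} (hk : 2 ≤ k) (x : Fin k) :
    centredBinary x * centredBinary x ≤ 1 := by
  have h0 : (0 : ℝ) < k := by positivity
  have h1 : (2 : ℝ) / k ≤ 1 := by
    rw [div_le_one h0]; exact_mod_cast hk
  have h2 : (0 : ℝ) < 2 / k := by positivity
  unfold centredBinary
  split_ifs <;> nlinarith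

theorem sum_centredBinary_eq {k n : ℕ} (x : Fin n → Fin k) :
    ∑ j, centredBinary (x j) = (binaryPositions x).card - 2 / k * n := by
  simp [centredBinary, binaryPositions, Finset.sum_sub_distrib, mul_comm]

theorem sum_centredBinary_mul_eq_zero {k d n : ℕ} (hk : 2 ≤ k) (i : Fin d) {j j' : Fin n}
    (hj : j ≠ j') :
    ∑ X : Fin d → Fin n → Fin k, centredBinary (X i j) * centredBinary (X i j') = 0 := by
  have : NeZero k := ⟨by omega⟩
  let π : (Fin d → Fin n → Fin k) →+ Fin k × Fin k :=
    { toFun := fun X => (X i j, X i j')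
      map_zero' := rfl
      map_add' := fun _ _ => rfl }
  have hπ : Function.Surjective π := by
    rintro ⟨a, b⟩
    refine ⟨fun _ l => if l = j then a else b, ?_⟩
    simp [π, hj.symm]
  have h := sum_comp_surjective_addMonoidHom π hπ (fun p => centredBinary p.1 * centredBinary p.2)
  rw [Fintype.sum_prod_type] at h
  simp only [← Finset.mul_sum, sum_centredBinary hk, mul_zero, Finset.sum_const_zero] at h
  have hc : (Fintype.card (Fin k × Fin k) : ℝ) ≠ 0 := by
    exact_mod_cast Fintype.card_ne_zero
  exact (mul_eq_zero.mp h).resolve_left hc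

theorem sum_sq_card_binaryPositions_sub_le {k d n : ℕ} (hk : 2 ≤ k) (i : Fin d) :
    ∑ X : Fin d → Fin n → Fin k, (((binaryPositions (X i)).card : ℝ) - 2 / k * n) ^ 2 ≤
      (Fintype.card (Fin d → Fin n → Fin k) : ℝ) * n := by
  calc _ = ∑ j : Fin n, ∑ j' : Fin n, ∑ X : Fin d → Fin n → Fin k,
        centredBinary (X i j) * centredBinary (X i j') := by
        simp only [← sum_centredBinary_eq, sq, Finset.sum_mul_sum]
        rw [Finset.sum_comm]
        exact Finset.sum_congr rfl fun j _ => Finset.sum_comm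
    _ = ∑ j : Fin n, ∑ X : Fin d → Fin n → Fin k,
        centredBinary (X i j) * centredBinary (X i j) :=
        Finset.sum_congr rfl fun j _ => Finset.sum_eq_single j
          (fun j' _ hj => sum_centredBinary_mul_eq_zero hk i hj.symm) (by simp)
    _ ≤ ∑ j : Fin n, ∑ X : Fin d → Fin n → Fin k, (1 : ℝ) :=
        Finset.sum_le_sum fun j _ => Finset.sum_le_sum fun X _ => centredBinary_sq_le hk _
    _ = _ := by
        rw [Finset.sum_const, Finset.sum_const, Finset.card_univ, Finset.card_univ]
        simp [mul_comm]

theorem sum_abs_card_binaryPositions_sub_le {k d n : ℕ} (hk : 2 ≤ k) (hn : 0 < n) (i : Fin d) :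
    ∑ X : Fin d → Fin n → Fin k, |((binaryPositions (X i)).card : ℝ) - 2 / k * n| ≤
      (Fintype.card (Fin d → Fin n → Fin k) : ℝ) * √n := by
  have hs : 0 < √(n : ℝ) := Real.sqrt_pos.mpr (by exact_mod_cast hn)
  have hss : √(n : ℝ) * √n = n := Real.mul_self_sqrt (by positivity)
  refine le_of_mul_le_mul_left ?_ (mul_pos two_pos hs)
  calc _ = ∑ X : Fin d → Fin n → Fin k,
        2 * √n * |((binaryPositions (X i)).card : ℝ) - 2 / k * n| := Finset.mul_sum _ _ _
    _ ≤ ∑ X : Fin d → Fin n → Fin k,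
        ((((binaryPositions (X i)).card : ℝ) - 2 / k * n) ^ 2 + n) := by
        refine Finset.sum_le_sum fun X _ => ?_
        rw [← sq_abs]
        nlinarith [sq_nonneg (|((binaryPositions (X i)).card : ℝ) - 2 / k * n| - √n)]
    _ ≤ Fintype.card (Fin d → Fin n → Fin k) * n + Fintype.card (Fin d → Fin n → Fin k) * n := by
        rw [Finset.sum_add_distrib, Finset.sum_const, Finset.card_univ, nsmul_eq_mul]
        exact add_le_add_left (sum_sq_card_binaryPositions_sub_le hk i) _
    _ = _ := by
        linear_combination -2 * (Fintype.card (Fin d → Fin n → Fin k) : ℝ) * hss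

/-- A linear lower bound on binary expectations transfers to `k`-ary ones. -/
theorem le_expLCS_of_linear_le {k d n : ℕ} (hk : 2 ≤ k) (hd : 0 < d) (hn : 0 < n) {α C : ℝ}
    (hα : 0 ≤ α) (h : ∀ m : ℕ, α * m - C ≤ expLCS 2 d m) :
    α * (2 / k * n - d * √n) - C ≤ expLCS k d n := by
  have : NeZero k := ⟨by omega⟩
  have : Nonempty (Fin d) := ⟨⟨0, hd⟩⟩
  have hm (X : Fin d → Fin n → Fin k) : ∃ m : ℕ, (∀ i, m ≤ (binaryPositions (X i)).card) ∧
      2 / (k : ℝ) * n - ∑ i, |((binaryPositions (X i)).card : ℝ) - 2 / k * n| ≤ m := by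
    obtain ⟨i₀, hi₀⟩ := Finite.exists_min fun i => (binaryPositions (X i)).card
    refine ⟨_, hi₀, ?_⟩
    have h1 := Finset.single_le_sum
      (f := fun i => |((binaryPositions (X i)).card : ℝ) - 2 / k * n|)
      (fun i _ => abs_nonneg _) (Finset.mem_univ i₀)
    have h2 := neg_abs_le (((binaryPositions (X i₀)).card : ℝ) - 2 / k * n)
    linarith
  choose m hm₁ hm₂ using hm
  have hN : (0 : ℝ) < Fintype.card (Fin d → Fin n → Fin k) := by
    exact_mod_cast Fintype.card_pos
  unfold expLCS
  rw [le_div_iff₀ hN]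
  refine le_trans ?_ (sum_expLCS_two_le hk hd m hm₁)
  calc _ ≤ ∑ X : Fin d → Fin n → Fin k, (α * (2 / (k : ℝ) * n -
        ∑ i, |((binaryPositions (X i)).card : ℝ) - 2 / k * n|) - C) := by
        rw [Finset.sum_sub_distrib, ← Finset.mul_sum, Finset.sum_sub_distrib, Finset.sum_comm]
        simp only [Finset.sum_const, Finset.card_univ, nsmul_eq_mul]
        have h1 : ∑ i : Fin d, ∑ X : Fin d → Fin n → Fin k,
            |((binaryPositions (X i)).card : ℝ) - 2 / k * n| ≤
            d * (Fintype.card (Fin d → Fin n → Fin k) * √n) := by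
          refine (Finset.sum_le_sum fun i _ =>
            sum_abs_card_binaryPositions_sub_le hk hn i).trans_eq ?_
          simp
        nlinarith [mul_le_mul_of_nonneg_left h1 hα]
    _ ≤ _ := Finset.sum_le_sum fun X _ =>
        (sub_le_sub_right (mul_le_mul_of_nonneg_left (hm₂ X) hα) C).trans (h (m X))

theorem expLCS_div_mem_Icc (k d n : ℕ) (hd : 0 < d) : expLCS k d n / n ∈ Set.Icc (0 : ℝ) 1 :=
  ⟨div_nonneg (expLCS_nonneg k d n) n.cast_nonneg,
    div_le_one_of_le₀ (expLCS_le k d n hd) n.cast_nonneg⟩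

theorem mul_le_liminf_expLCS {k d : ℕ} (hk : 2 ≤ k) (hd : 0 < d) {α : ℝ} (hα : 0 ≤ α)
    (h : α < liminf (fun n : ℕ => expLCS 2 d n / n) atTop) :
    α * (2 / k) ≤ liminf (fun n : ℕ => expLCS k d n / n) atTop := by
  have hev := eventually_lt_of_lt_liminf h
    ⟨0, eventually_map.mpr (.of_forall fun n => (expLCS_div_mem_Icc 2 d n hd).1)⟩
  obtain ⟨M, hM⟩ := eventually_atTop.mp hev
  have hlin (m : ℕ) : α * m - α * M ≤ expLCS 2 d m := by
    rcases le_total m M with hmM | hmM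
    · have : α * m ≤ α * M := by gcongr
      linarith [expLCS_nonneg 2 d m]
    · rcases m.eq_zero_or_pos with rfl | hpos
      · have : 0 ≤ α * M := by positivity
        simpa using (neg_nonpos.mpr this).trans (expLCS_nonneg 2 d 0)
      · have h1 := (lt_div_iff₀ (by exact_mod_cast hpos)).mp (hM m hmM)
        have : 0 ≤ α * M := by positivity
        linarith
  have ht : Tendsto (fun n : ℕ => α * (2 / k) - α * d * (√(n : ℝ))⁻¹ - α * M * (n : ℝ)⁻¹) atTop
      (𝓝 (α * (2 / k))) := by
    have h1 : Tendsto (fun n : ℕ => (√(n : ℝ))⁻¹) atTop (𝓝 0) :=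
      (Real.tendsto_sqrt_atTop.comp tendsto_natCast_atTop_atTop).inv_tendsto_atTop
    have h2 : Tendsto (fun n : ℕ => (n : ℝ)⁻¹) atTop (𝓝 0) :=
      tendsto_natCast_atTop_atTop.inv_tendsto_atTop
    simpa using (tendsto_const_nhds.sub (h1.const_mul (α * d))).sub (h2.const_mul (α * M))
  rw [← ht.liminf_eq]
  refine liminf_le_liminf ?_ ht.isBoundedUnder_ge
    (isBoundedUnder_of ⟨1, fun n => (expLCS_div_mem_Icc k d n hd).2⟩).isCoboundedUnder_ge
  filter_upwards [eventually_gt_atTop 0] with n hn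
  have hn' : (0 : ℝ) < n := by exact_mod_cast hn
  rw [le_div_iff₀ hn']
  refine le_of_eq_of_le ?_ (le_expLCS_of_linear_le hk hd hn hα hlin)
  have hs : 0 < √(n : ℝ) := Real.sqrt_pos.mpr hn'
  have h1 : (√(n : ℝ))⁻¹ * n = √n := by
    rw [inv_mul_eq_div, Real.div_sqrt]
  have h2 : (n : ℝ)⁻¹ * n = 1 := inv_mul_cancel₀ hn'.ne'
  linear_combination -(α * d) * h1 - α * M * h2

/-- For all `k ≥ 2` and `d ≥ 2`,
`liminf_{n→∞} E_{k,d}(n)/n ≥ (2/k)·liminf_{n→∞} E_{2,d}(n)/n`,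
i.e. `γ_{k,d} ≥ (2/k)·γ_{2,d}`. -/
theorem kary_from_binary (k d : ℕ) (hk : 2 ≤ k) (hd : 2 ≤ d) :
    (2 / (k : ℝ)) * Filter.liminf (fun n : ℕ => expLCS 2 d n / n) Filter.atTop ≤
      Filter.liminf (fun n : ℕ => expLCS k d n / n) Filter.atTop := by
  have hd0 : 0 < d := by omega
  have hp : (0 : ℝ) < 2 / k := by positivity
  rw [mul_comm, ← le_div_iff₀ hp]
  refine le_of_forall_lt_imp_le_of_dense fun α hα => ?_
  rw [le_div_iff₀ hp]
  rcases le_total 0 α with h0 | h0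
  · exact mul_le_liminf_expLCS hk hd0 h0 hα
  · refine (mul_nonpos_of_nonpos_of_nonneg h0 hp.le).trans ?_
    exact le_liminf_of_le
      (isBoundedUnder_of ⟨1, fun n => (expLCS_div_mem_Icc k d n hd0).2⟩).isCoboundedUnder_ge
      (.of_forall fun n => (expLCS_div_mem_Icc k d n hd0).1)
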